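/- arXiv:math/0001049 — 3 statements merged into one kernel-verified Lean document; each statement's English description precedes it below -/
import Mathlib

section
/- Let K be a field and S a positive normal affine semigroup with gp(S) = ℤ^r, support forms σ_1,…,σ_s and standard embedding of R = K[S] into the polynomial ring P = K[Y_1,…,Y_s] sending the monomial of x ∈ S to Y^{σ(x)}. For each class c ∈ Cl(R) = ℤ^s/σ(ℤ^r) let M_c ⊆ P be the K-span of all monomials Y^t, t ∈ ℤ_+^s, whose residue class in ℤ^s/σ(ℤ^r) equals −c. Then each M_c is an R-submodule of P, P is the internal direct sum of the submodules M_c over all c ∈ Cl(R), and for every representative a ∈ ℤ^s of c multiplication by Y^{−a} induces an R-module isomorphism from the divisorial ideal D(a) onto M_c; in particular M_c is isomorphic to a divisorial ideal of class c. -/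
set_option synthInstance.maxHeartbeats 1000000
set_option maxHeartbeats 1000000

open scoped BigOperators

noncomputable section

/-- Pairing of an integral linear form (given by its coefficient vector `f`) with `x`. -/
def lin {r : ℕ} (f x : Fin r → ℤ) : ℤ := ∑ k, f k * x k

lemma lin_zero {r : ℕ} (f : Fin r → ℤ) : lin f 0 = 0 := by simp [lin]

lemma lin_add {r : ℕ} (f x y : Fin r → ℤ) : lin f (x + y) = lin f x + lin f y := by
  simp [lin, mul_add, Finset.sum_add_distrib]

/-- A family of integral linear forms, bundled as an additive homomorphism `ℤ^r → ℤ^s`. -/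
def formsHom {r s : ℕ} (σ : Fin s → Fin r → ℤ) : (Fin r → ℤ) →+ (Fin s → ℤ) where
  toFun x i := lin (σ i) x
  map_zero' := by funext i; simp [lin_zero]
  map_add' x y := by funext i; simp [lin_add]

/-- The subgroup `σ(ℤ^r) ⊆ ℤ^s`. -/
def formsRange {r s : ℕ} (σ : Fin s → Fin r → ℤ) : AddSubgroup (Fin s → ℤ) :=
  (formsHom σ).range

/-- The divisor class group `Cl(R) = ℤ^s / σ(ℤ^r)`. -/
abbrev classGroup {r s : ℕ} (σ : Fin s → Fin r → ℤ) : Type :=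
  (Fin s → ℤ) ⧸ formsRange σ

/-- The set of solutions of the inhomogeneous system of inequalities `σ_i(x) ≥ a_i`. -/
def Tset {r s : ℕ} (σ : Fin s → Fin r → ℤ) (a : Fin s → ℤ) : Set (Fin r → ℤ) :=
  {x | ∀ i, a i ≤ lin (σ i) x}

/-- The monomial of exponent `x` in the group algebra `K[ℤ^r]`. -/
def mono (K : Type*) [Field K] {r : ℕ} (x : Fin r → ℤ) : AddMonoidAlgebra K (Fin r → ℤ) :=
  AddMonoidAlgebra.single x 1

/-- The affine semigroup ring `K[S]`, as a subalgebra of `K[ℤ^r]`. -/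
def semigroupRing (K : Type*) [Field K] {r : ℕ} (S : AddSubmonoid (Fin r → ℤ)) :
    Subalgebra K (AddMonoidAlgebra K (Fin r → ℤ)) :=
  Algebra.adjoin K {f | ∃ x ∈ S, f = mono K x}

/-- The monomial (fractional) ideal of `K[S]` with monomial basis `T ⊆ ℤ^r`, as a
`K[S]`-submodule of `K[ℤ^r]`.  (When `S + T ⊆ T`, its underlying set is the `K`-span
of the monomials with exponents in `T`.) -/
def monIdeal (K : Type*) [Field K] {r : ℕ} (S : AddSubmonoid (Fin r → ℤ))
    (T : Set (Fin r → ℤ)) :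
    Submodule ↥(semigroupRing K S) (AddMonoidAlgebra K (Fin r → ℤ)) :=
  Submodule.span _ {f | ∃ x ∈ T, f = mono K x}

/-- The maximal ideal of `K[S]` generated by all nonunit monomials. -/
def irrelevantIdeal (K : Type*) [Field K] {r : ℕ} (S : AddSubmonoid (Fin r → ℤ)) :
    Ideal ↥(semigroupRing K S) :=
  Ideal.span {f | ∃ x ∈ S, x ≠ 0 ∧ (f : AddMonoidAlgebra K (Fin r → ℤ)) = mono K x}

/-- `M` is a Cohen–Macaulay module with respect to the ideal `I ⊆ R`: the length of a
maximal `M`-regular sequence contained in `I` equals the Krull dimension of `M`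
(the Krull dimension of `R/ann(M)`). -/
def IsCohenMacaulayMod (R : Type*) [CommRing R] (I : Ideal R)
    (M : Type*) [AddCommGroup M] [Module R M] : Prop :=
  ∃ rs : List R, (∀ x ∈ rs, x ∈ I) ∧ RingTheory.Sequence.IsRegular M rs ∧
    (∀ y ∈ I, ¬ RingTheory.Sequence.IsRegular M (rs ++ [y])) ∧
    (rs.length : WithBot ℕ∞) = ringKrullDim (R ⧸ Module.annihilator R M)

/-- The image `σ(S)` of `S` under the standard embedding, as a submonoid of `ℤ^s`. -/
def stdImage {r s : ℕ} (S : AddSubmonoid (Fin r → ℤ)) (σ : Fin s → Fin r → ℤ) :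
    AddSubmonoid (Fin s → ℤ) :=
  S.map (formsHom σ)

/-- The standard-embedding copy of `R = K[S]` inside `K[ℤ^s]`: the subalgebra spanned
by the monomials `Y^{σ(x)}`, `x ∈ S`. -/
def stdRing (K : Type*) [Field K] {r s : ℕ} (S : AddSubmonoid (Fin r → ℤ))
    (σ : Fin s → Fin r → ℤ) : Subalgebra K (AddMonoidAlgebra K (Fin s → ℤ)) :=
  semigroupRing K (stdImage S σ)

/-- The polynomial ring `P = K[Y_1,…,Y_s]` inside `K[ℤ^s]`: the span of the monomials
with nonnegative exponents (over the standard-embedding copy of `R = K[S]`). -/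
def polyPart (K : Type*) [Field K] {r s : ℕ} (S : AddSubmonoid (Fin r → ℤ))
    (σ : Fin s → Fin r → ℤ) :
    Submodule ↥(stdRing K S σ) (AddMonoidAlgebra K (Fin s → ℤ)) :=
  Submodule.span _ {f | ∃ t : Fin s → ℤ, (∀ i, 0 ≤ t i) ∧ f = mono K t}

/-- The coset module `M_c ⊆ P`: the span of all monomials `Y^t`, `t ∈ ℤ_+^s`, whose
residue class in `ℤ^s/σ(ℤ^r)` equals `−c`. -/
def cosetModule (K : Type*) [Field K] {r s : ℕ} (S : AddSubmonoid (Fin r → ℤ))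
    (σ : Fin s → Fin r → ℤ) (c : classGroup σ) :
    Submodule ↥(stdRing K S σ) (AddMonoidAlgebra K (Fin s → ℤ)) :=
  Submodule.span _ {f | ∃ t : Fin s → ℤ, (∀ i, 0 ≤ t i) ∧
    QuotientAddGroup.mk' (formsRange σ) t = -c ∧ f = mono K t}

/-- The divisorial ideal `D(a)`, realized inside `K[ℤ^s]` via the standard embedding:
the span of the monomials `Y^{σ(x)}`, `x ∈ T(a)`. -/
def stdDivIdeal (K : Type*) [Field K] {r s : ℕ} (S : AddSubmonoid (Fin r → ℤ))
    (σ : Fin s → Fin r → ℤ) (a : Fin s → ℤ) :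
    Submodule ↥(stdRing K S σ) (AddMonoidAlgebra K (Fin s → ℤ)) :=
  Submodule.span _ {f | ∃ x ∈ Tset σ a, f = mono K (formsHom σ x)}

lemma mono_mul_mono (K : Type*) [Field K] {r : ℕ} (x y : Fin r → ℤ) :
    mono K x * mono K y = mono K (x + y) := by
  simp [mono, AddMonoidAlgebra.single_mul_single]

/-- The monomial of exponent `x`, as a unit of the group algebra. -/
def monoUnit (K : Type*) [Field K] {r : ℕ} (x : Fin r → ℤ) :
    (AddMonoidAlgebra K (Fin r → ℤ))ˣ where
  val := mono K x
  inv := mono K (-x)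
  val_inv := by rw [mono_mul_mono, add_neg_cancel]; rfl
  inv_val := by rw [mono_mul_mono, neg_add_cancel]; rfl

lemma mono_mul_mem_supported {K : Type*} [Field K] {r : ℕ} {T : Set (Fin r → ℤ)}
    {x : Fin r → ℤ} (hx : ∀ t ∈ T, x + t ∈ T) {f : AddMonoidAlgebra K (Fin r → ℤ)}
    (hf : f ∈ AddMonoidAlgebra.supported K K T) :
    mono K x * f ∈ AddMonoidAlgebra.supported K K T := by
  rw [AddMonoidAlgebra.mem_supported'] at hf ⊢
  intro t ht
  rw [mono, AddMonoidAlgebra.coeff_single_mul_apply, hf, mul_zero]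
  exact fun h => ht (by simpa using hx _ h)

lemma semigroupRing_mul_mem_supported {K : Type*} [Field K] {r : ℕ}
    {S : AddSubmonoid (Fin r → ℤ)} {T : Set (Fin r → ℤ)}
    (hT : ∀ x ∈ S, ∀ t ∈ T, x + t ∈ T) {g : AddMonoidAlgebra K (Fin r → ℤ)}
    (hg : g ∈ semigroupRing K S) {f : AddMonoidAlgebra K (Fin r → ℤ)}
    (hf : f ∈ AddMonoidAlgebra.supported K K T) :
    g * f ∈ AddMonoidAlgebra.supported K K T := by
  induction hg using Algebra.adjoin_induction generalizing f with
  | mem g hg =>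
    obtain ⟨x, hx, rfl⟩ := hg
    exact mono_mul_mem_supported (hT x hx) hf
  | algebraMap k =>
    rw [← Algebra.smul_def]
    exact Submodule.smul_mem _ k hf
  | add a b _ _ ha hb =>
    rw [add_mul]
    exact Submodule.add_mem _ (ha hf) (hb hf)
  | mul a b _ _ ha hb =>
    rw [mul_assoc]
    exact ha (hb hf)

/-- If `S + T ⊆ T`, the elements of the monomial ideal of `T` are supported on `T`. -/
lemma mem_supported_of_mem_monIdeal {K : Type*} [Field K] {r : ℕ}
    {S : AddSubmonoid (Fin r → ℤ)} {T : Set (Fin r → ℤ)}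
    (hT : ∀ x ∈ S, ∀ t ∈ T, x + t ∈ T) {f : AddMonoidAlgebra K (Fin r → ℤ)}
    (hf : f ∈ monIdeal K S T) : f ∈ AddMonoidAlgebra.supported K K T := by
  induction hf using Submodule.span_induction with
  | mem f hf =>
    obtain ⟨x, hx, rfl⟩ := hf
    rw [AddMonoidAlgebra.mem_supported']
    intro t ht
    rw [mono, AddMonoidAlgebra.coeff_single, Finsupp.single_eq_of_ne]
    rintro rfl
    exact ht hx
  | zero => exact Submodule.zero_mem _
  | add f g _ _ hf hg => exact Submodule.add_mem _ hf hg
  | smul g f _ hf => exact semigroupRing_mul_mem_supported hT g.2 hf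

lemma monIdeal_mono (K : Type*) [Field K] {r : ℕ} (S : AddSubmonoid (Fin r → ℤ))
    {T U : Set (Fin r → ℤ)} (h : T ⊆ U) : monIdeal K S T ≤ monIdeal K S U :=
  Submodule.span_mono fun _ ⟨x, hx, hf⟩ => ⟨x, h hx, hf⟩

lemma disjoint_monIdeal {K : Type*} [Field K] {r : ℕ} {S : AddSubmonoid (Fin r → ℤ)}
    {T U : Set (Fin r → ℤ)} (hT : ∀ x ∈ S, ∀ t ∈ T, x + t ∈ T)
    (hU : ∀ x ∈ S, ∀ t ∈ U, x + t ∈ U) (hTU : Disjoint T U) :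
    Disjoint (monIdeal K S T) (monIdeal K S U) := by
  rw [Submodule.disjoint_def]
  intro f hfT hfU
  have hT' := AddMonoidAlgebra.mem_supported'.1 (mem_supported_of_mem_monIdeal hT hfT)
  have hU' := AddMonoidAlgebra.mem_supported'.1 (mem_supported_of_mem_monIdeal hU hfU)
  ext t
  by_cases ht : t ∈ T
  · exact hU' t (Set.disjoint_left.1 hTU ht)
  · exact hT' t ht

lemma cosetModule_eq_monIdeal (K : Type*) [Field K] {r s : ℕ} (S : AddSubmonoid (Fin r → ℤ))
    (σ : Fin s → Fin r → ℤ) (c : classGroup σ) :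
    cosetModule K S σ c = monIdeal K (stdImage S σ)
      {t | (∀ i, 0 ≤ t i) ∧ QuotientAddGroup.mk' (formsRange σ) t = -c} := by
  simp only [cosetModule, monIdeal, stdRing, Set.mem_ofPred_eq, and_assoc]
  rfl

lemma mk_stdImage {r s : ℕ} {S : AddSubmonoid (Fin r → ℤ)} {σ : Fin s → Fin r → ℤ}
    {y : Fin s → ℤ} (hy : y ∈ stdImage S σ) :
    QuotientAddGroup.mk' (formsRange σ) y = 0 := by
  obtain ⟨x, -, rfl⟩ := hy
  exact (QuotientAddGroup.eq_zero_iff _).2 ⟨x, rfl⟩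

lemma iSup_cosetModule (K : Type*) [Field K] {r s : ℕ} (S : AddSubmonoid (Fin r → ℤ))
    (σ : Fin s → Fin r → ℤ) :
    (⨆ c : classGroup σ, cosetModule K S σ c) = polyPart K S σ := by
  simp only [cosetModule, polyPart]
  rw [← Submodule.span_iUnion]
  congr 1
  ext f
  simp only [Set.mem_iUnion, Set.mem_ofPred_eq]
  constructor
  · rintro ⟨c, t, ht, -, rfl⟩
    exact ⟨t, ht, rfl⟩
  · rintro ⟨t, ht, rfl⟩
    exact ⟨-QuotientAddGroup.mk' (formsRange σ) t, t, ht, (neg_neg _).symm, rfl⟩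

lemma iSupIndep_cosetModule (K : Type*) [Field K] {r s : ℕ} {S : AddSubmonoid (Fin r → ℤ)}
    {σ : Fin s → Fin r → ℤ} (hS : ∀ x ∈ S, ∀ i, 0 ≤ lin (σ i) x) :
    iSupIndep (fun c : classGroup σ => cosetModule K S σ c) := by
  have hnonneg : ∀ y ∈ stdImage S σ, ∀ i, 0 ≤ y i := by
    rintro _ ⟨x, hx, rfl⟩
    exact hS x hx
  intro c
  have hle : (⨆ d : classGroup σ, ⨆ _ : d ≠ c, cosetModule K S σ d) ≤
      monIdeal K (stdImage S σ)
        {t | (∀ i, 0 ≤ t i) ∧ QuotientAddGroup.mk' (formsRange σ) t ≠ -c} := by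
    refine iSup₂_le fun d hd => ?_
    rw [cosetModule_eq_monIdeal]
    exact monIdeal_mono K _ fun t ht => ⟨ht.1, fun h => hd (neg_injective (ht.2.symm.trans h))⟩
  refine Disjoint.mono_right hle ?_
  change Disjoint (cosetModule K S σ c) _
  rw [cosetModule_eq_monIdeal]
  refine disjoint_monIdeal ?_ ?_ (Set.disjoint_left.2 fun t ht ht' => ht'.2 ht.2)
  all_goals
    intro y hy t ht
    refine ⟨fun i => add_nonneg (hnonneg y hy i) (ht.1 i), ?_⟩
    rw [map_add, mk_stdImage hy, zero_add]
    exact ht.2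

lemma map_stdDivIdeal (K : Type*) [Field K] {r s : ℕ} (S : AddSubmonoid (Fin r → ℤ))
    (σ : Fin s → Fin r → ℤ) (a : Fin s → ℤ) :
    (stdDivIdeal K S σ a).map
        ((monoUnit K (-a)).mulLeftLinearEquiv (stdRing K S σ)
          (AddMonoidAlgebra K (Fin s → ℤ))).toLinearMap =
      cosetModule K S σ (QuotientAddGroup.mk' (formsRange σ) a) := by
  rw [stdDivIdeal, cosetModule, Submodule.map_span]
  congr 1
  ext f
  constructor
  · rintro ⟨_, ⟨x, hx, rfl⟩, rfl⟩
    refine ⟨-a + formsHom σ x, fun i => ?_, ?_, mono_mul_mono K _ _⟩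
    · have := hx i
      change 0 ≤ -a i + lin (σ i) x
      omega
    · rw [map_add, map_neg]
      exact add_eq_left.2 ((QuotientAddGroup.eq_zero_iff _).2 ⟨x, rfl⟩)
  · rintro ⟨t, ht, hta, rfl⟩
    have hmem : a + t ∈ formsRange σ := by
      rw [← QuotientAddGroup.eq_zero_iff]
      change QuotientAddGroup.mk' (formsRange σ) (a + t) = 0
      rw [map_add, hta, add_neg_cancel]
    obtain ⟨x, hx⟩ := hmem
    refine ⟨mono K (formsHom σ x), ⟨x, fun i => ?_, rfl⟩, ?_⟩
    · have h : lin (σ i) x = a i + t i := congrFun hx i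
      have := ht i
      omega
    · change mono K (-a) * mono K (formsHom σ x) = mono K t
      rw [hx, mono_mul_mono, neg_add_cancel_left]

/-- Theorem: decomposition of the standard embedding.
Each coset module `M_c` is an `R`-submodule of `P`; `P` is the internal direct sum of the
`M_c`, `c ∈ Cl(R) = ℤ^s/σ(ℤ^r)`; and for every representative `a ∈ ℤ^s` of the class `c`,
multiplication by `Y^{-a}` induces an `R`-module isomorphism of the divisorial ideal `D(a)`
onto `M_c`; in particular `M_c` is isomorphic to a divisorial ideal of class `c`. -/
theorem standard_embedding_decomposition
    {r s : ℕ} (K : Type*) [Field K]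
    (S : AddSubmonoid (Fin r → ℤ)) (σ : Fin s → Fin r → ℤ)
    (hSfg : S.FG)
    (hSpos : ∀ x ∈ S, -x ∈ S → x = 0)
    (hSgp : ∀ x : Fin r → ℤ, ∃ a ∈ S, ∃ b ∈ S, x = a - b)
    (hrep : ∀ x : Fin r → ℤ, x ∈ S ↔ ∀ i, 0 ≤ lin (σ i) x)
    (hirr : ∀ j, ∃ x : Fin r → ℤ, lin (σ j) x < 0 ∧ ∀ i, i ≠ j → 0 ≤ lin (σ i) x)
    (hprim : ∀ i, Finset.univ.gcd (σ i) = 1) :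
    (∀ (c : classGroup σ) (x : Fin r → ℤ), x ∈ S →
      ∀ f ∈ cosetModule K S σ c, mono K (formsHom σ x) * f ∈ cosetModule K S σ c) ∧
    (⨆ c : classGroup σ, cosetModule K S σ c) = polyPart K S σ ∧
    iSupIndep (fun c : classGroup σ => cosetModule K S σ c) ∧
    (∀ a : Fin s → ℤ,
      ∃ e : ↥(stdDivIdeal K S σ a) ≃ₗ[↥(stdRing K S σ)]
          ↥(cosetModule K S σ (QuotientAddGroup.mk' (formsRange σ) a)),
        ∀ (f : AddMonoidAlgebra K (Fin s → ℤ)) (hf : f ∈ stdDivIdeal K S σ a),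
          (↑(e ⟨f, hf⟩) : AddMonoidAlgebra K (Fin s → ℤ)) = mono K (-a) * f) := by
  refine ⟨fun c x hx f hf => ?_, iSup_cosetModule K S σ,
    iSupIndep_cosetModule K fun x hx => (hrep x).1 hx, fun a => ?_⟩
  · exact Submodule.smul_mem _
      (⟨mono K (formsHom σ x), Algebra.subset_adjoin ⟨_, ⟨x, hx, rfl⟩, rfl⟩⟩ : stdRing K S σ) hf
  · exact ⟨LinearEquiv.ofSubmodules _ _ _ (map_stdDivIdeal K S σ a), fun f hf => rfl⟩
end
end

section
/- Let S be a positive normal affine semigroup with gp(S) = ℤ^r and support forms σ_1,…,σ_s, and let ξ_1,…,ξ_n : ℤ^r → ℤ be linear forms with ξ_i(x) ≥ 0 for all x ∈ S and such that ξ = (ξ_1,…,ξ_n) : ℤ^r → ℤ^n is injective on S. Then ξ(S) is a pure subsemigroup of ℤ_+^n, i.e. ξ(S) = ℤ_+^n ∩ ξ(ℤ^r), if and only if n ≥ s and there are an injective map ι : {1,…,s} → {1,…,n} and positive integers e_1,…,e_s with ξ_{ι(i)} = e_i σ_i for i = 1,…,s. Moreover, in that case every ξ_j, 1 ≤ j ≤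 n, is a linear combination of σ_1,…,σ_s with nonnegative rational coefficients. -/
set_option synthInstance.maxHeartbeats 1000000
set_option maxHeartbeats 1000000

open scoped BigOperators

noncomputable section

/-- **Farkas' lemma** for finitely many linear forms over an ordered field. -/
theorem exists_nonneg_sum_smul_eq_of_forall_nonneg {K E : Type*} [Field K] [LinearOrder K]
    [IsStrictOrderedRing K] [AddCommGroup E] [Module K E] {m : ℕ} (g : Fin m → E →ₗ[K] K)
    (f : E →ₗ[K] K) (h : ∀ x, (∀ i, 0 ≤ g i x) → 0 ≤ f x) :
    ∃ q : Fin m → K, (∀ i, 0 ≤ q i) ∧ f = ∑ i, q i • g i := by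
  induction m generalizing f with
  | zero =>
    refine ⟨0, fun _ => le_rfl, ?_⟩
    ext x
    have h1 := h x (fun i => i.elim0)
    have h2 := h (-x) (fun i => i.elim0)
    rw [map_neg] at h2
    simpa using le_antisymm (by linarith) h1
  | succ m ih =>
    by_cases hf : ∀ x, (∀ i : Fin m, 0 ≤ g i.succ x) → 0 ≤ f x
    · obtain ⟨q, hq, hfq⟩ := ih (fun i => g i.succ) f hf
      refine ⟨Fin.cons 0 q, Fin.cases le_rfl hq, ?_⟩
      simpa [Fin.sum_univ_succ] using hfq
    push Not at hf
    obtain ⟨x, hx, hfx⟩ := hf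
    have hgx : g 0 x < 0 := by
      by_contra! h0
      exact hfx.not_ge (h x (Fin.cases h0 hx))
    set c : K := -(g 0 x)⁻¹ with hc
    have hc0 : 0 < c := neg_pos.2 (inv_lt_zero.2 hgx)
    have hcx : c * g 0 x = -1 := by rw [hc, neg_mul, inv_mul_cancel₀ hgx.ne]
    obtain ⟨q, hq, hfq⟩ := ih (fun i => g i.succ + (c * g i.succ x) • g 0)
        (f + (c * f x) • g 0) (fun v hv => by
      have key : ∀ φ : E →ₗ[K] K, φ (v + (c * g 0 v) • x) = (φ + (c * φ x) • g 0) v := by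
        intro φ
        simp
        ring
      rw [← key]
      refine h _ (Fin.cases ?_ fun i => ?_)
      · rw [key]
        simp [hcx]
      · rw [key]
        exact hv i)
    have hq0 : 0 ≤ ∑ i, q i * (c * g i.succ x) - c * f x := by
      have h1 : 0 ≤ ∑ i, q i * (c * g i.succ x) :=
        Finset.sum_nonneg fun i _ => mul_nonneg (hq i) (mul_nonneg hc0.le (hx i))
      have h2 : c * f x < 0 := mul_neg_of_pos_of_neg hc0 hfx
      linarith
    refine ⟨Fin.cons _ q, Fin.cases hq0 hq, (eq_sub_of_add_eq hfq).trans ?_⟩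
    simp only [Fin.sum_univ_succ, Fin.cons_zero, Fin.cons_succ, smul_add, smul_smul,
      Finset.sum_add_distrib, ← Finset.sum_smul]
    module

lemma lin_eq_dotProduct {r : ℕ} (f x : Fin r → ℤ) : lin f x = f ⬝ᵥ x := rfl

lemma lin_smul {r : ℕ} (f x : Fin r → ℤ) (c : ℤ) : lin f (c • x) = c * lin f x := by
  rw [lin_eq_dotProduct, dotProduct_smul, smul_eq_mul, lin_eq_dotProduct]

lemma lin_sub {r : ℕ} (f x y : Fin r → ℤ) : lin f (x - y) = lin f x - lin f y := by
  simp [lin_eq_dotProduct]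

lemma lin_sum {r : ℕ} {α : Type*} (f : Fin r → ℤ) (t : Finset α) (x : α → Fin r → ℤ) :
    lin f (∑ i ∈ t, x i) = ∑ i ∈ t, lin f (x i) := by
  simp [lin_eq_dotProduct, dotProduct_sum]

lemma lin_smul_left {r : ℕ} (f x : Fin r → ℤ) (c : ℤ) : lin (c • f) x = c * lin f x := by
  rw [lin_eq_dotProduct, smul_dotProduct, smul_eq_mul, lin_eq_dotProduct]

lemma lin_single {r : ℕ} (f : Fin r → ℤ) (k : Fin r) : lin f (Pi.single k 1) = f k := by
  simp [lin_eq_dotProduct]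

/-- A form that is nonnegative at every integral point where the `σ i` are nonnegative is a
nonnegative rational combination of the `σ i`. -/
theorem exists_rat_coeffs_of_forall_nonneg {r s : ℕ} (σ : Fin s → Fin r → ℤ) (f : Fin r → ℤ)
    (h : ∀ x, (∀ i, 0 ≤ lin (σ i) x) → 0 ≤ lin f x) :
    ∃ q : Fin s → ℚ, (∀ i, 0 ≤ q i) ∧ ∀ k, (f k : ℚ) = ∑ i, q i * (σ i k : ℚ) := by
  let φ (g : Fin r → ℤ) : (Fin r → ℚ) →ₗ[ℚ] ℚ := dotProductBilin ℚ ℚ (fun k => (g k : ℚ))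
  have hφ (g : Fin r → ℤ) (x : Fin r → ℚ) : φ g x = ∑ k, (g k : ℚ) * x k := rfl
  obtain ⟨q, hq, hfq⟩ := exists_nonneg_sum_smul_eq_of_forall_nonneg (fun i => φ (σ i)) (φ f) (by
    intro x hx
    obtain ⟨N, hN⟩ := IsLocalization.exist_integer_multiples_of_finite (nonZeroDivisors ℤ) x
    choose z hz using hN
    have hN0 : (N : ℤ) ≠ 0 := nonZeroDivisors.coe_ne_zero N
    have hN2 : (0 : ℚ) < ((N : ℤ) : ℚ) ^ 2 := by positivity
    have key (g : Fin r → ℤ) :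
        ((lin g ((N : ℤ) • z) : ℤ) : ℚ) = ((N : ℤ) : ℚ) ^ 2 * φ g x := by
      rw [lin_smul, hφ, lin, Finset.mul_sum, Finset.mul_sum]
      push_cast
      refine Finset.sum_congr rfl fun k _ => ?_
      have hk : (z k : ℚ) = ((N : ℤ) : ℚ) * x k := by simpa using hz k
      rw [hk]
      ring
    have hf := h ((N : ℤ) • z) fun i => by
      have := mul_nonneg hN2.le (hx i)
      rw [← key] at this
      exact_mod_cast this
    have hf' : (0 : ℚ) ≤ ((lin f ((N : ℤ) • z) : ℤ) : ℚ) := by exact_mod_cast hf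
    rw [key] at hf'
    exact nonneg_of_mul_nonneg_right hf' hN2)
  refine ⟨q, hq, fun k => ?_⟩
  have := LinearMap.congr_fun hfq (Pi.single k 1)
  simpa [hφ, Pi.single_apply] using this

/-- Irredundance of the `σ i`, together with an integral point where all of them are positive,
gives an integral point in the relative interior of each facet. -/
theorem exists_lin_eq_zero_forall_ne_pos {r s : ℕ} {σ : Fin s → Fin r → ℤ} {j : Fin s}
    {x y : Fin r → ℤ} (hxj : lin (σ j) x < 0) (hx : ∀ i, i ≠ j → 0 ≤ lin (σ i) x)
    (hy : ∀ i, 0 < lin (σ i) y) :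
    ∃ z, lin (σ j) z = 0 ∧ ∀ i, i ≠ j → 0 < lin (σ i) z := by
  refine ⟨lin (σ j) y • x - lin (σ j) x • y, ?_, fun i hi => ?_⟩
  · rw [lin_sub, lin_smul, lin_smul]
    ring
  · rw [lin_sub, lin_smul, lin_smul]
    have := mul_nonneg (hy j).le (hx i hi)
    have := mul_neg_of_neg_of_pos hxj (hy i)
    linarith

/-- A finite family of positive integers eventually dominates: a large multiple of the first
family compensates the second one. -/
theorem exists_forall_pos_imp_nonneg_mul_add {α : Type*} [Fintype α] (a b : α → ℤ) :
    ∃ m : ℤ, ∀ i, 0 < a i → 0 ≤ m * a i + b i := by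
  refine ⟨∑ i, |b i|, fun i hi => ?_⟩
  have h1 : |b i| ≤ ∑ i, |b i| :=
    Finset.single_le_sum (fun i _ => abs_nonneg (b i)) (Finset.mem_univ i)
  nlinarith [neg_abs_le (b i), abs_nonneg (b i)]

/-- If the systems `0 ≤ σ` and `0 ≤ ξ` have the same integral solutions, then each facet form
`σ j` is, up to a positive integral factor, one of the forms `ξ i`. -/
theorem exists_eq_smul_of_nonneg_iff {r s n : ℕ} {σ : Fin s → Fin r → ℤ}
    {ξ : Fin n → Fin r → ℤ}
    (h : ∀ x, (∀ i, 0 ≤ lin (σ i) x) ↔ ∀ i, 0 ≤ lin (ξ i) x) {j : Fin s}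
    (hprim : Finset.univ.gcd (σ j) = 1) {x y : Fin r → ℤ} (hxj : lin (σ j) x < 0)
    (hx : ∀ i, i ≠ j → 0 ≤ lin (σ i) x) (hy : ∀ i, 0 < lin (σ i) y) :
    ∃ i, ∃ e : ℤ, 0 < e ∧ ξ i = e • σ j := by
  obtain ⟨z, hzj, hz⟩ := exists_lin_eq_zero_forall_ne_pos hxj hx hy
  have hzξ : ∀ i, 0 ≤ lin (ξ i) z := (h z).1 fun i => by
    rcases eq_or_ne i j with rfl | hi
    exacts [hzj.ge, (hz i hi).le]
  obtain ⟨i, hiz, hix⟩ : ∃ i, lin (ξ i) z = 0 ∧ lin (ξ i) x < 0 := by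
    by_contra! hne
    obtain ⟨m, hm⟩ := exists_forall_pos_imp_nonneg_mul_add
      (fun i => lin (ξ i) z) (fun i => lin (ξ i) x)
    have := (h (m • z + x)).2 (fun i => by
      rw [lin_add, lin_smul]
      rcases (hzξ i).eq_or_lt with h0 | h0
      · rw [← h0, mul_zero, zero_add]
        exact hne i h0.symm
      · exact hm i h0) j
    rw [lin_add, lin_smul, hzj] at this
    linarith
  have hpos : ∀ v, 0 ≤ lin (σ j) v → 0 ≤ lin (ξ i) v := by
    intro v hv
    obtain ⟨m, hm⟩ := exists_forall_pos_imp_nonneg_mul_add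
      (fun i => lin (σ i) z) (fun i => lin (σ i) v)
    have := (h (m • z + v)).1 (fun k => by
      rw [lin_add, lin_smul]
      rcases eq_or_ne k j with rfl | hk
      · rwa [hzj, mul_zero, zero_add]
      · exact hm k (hz k hk)) i
    rwa [lin_add, lin_smul, hiz, mul_zero, zero_add] at this
  have hprop : ∀ k, lin (σ j) x * ξ i k = lin (ξ i) x * σ j k := by
    intro k
    have h1 := hpos (lin (σ j) x • Pi.single k 1 - σ j k • x) (by
      rw [lin_sub, lin_smul, lin_smul, lin_single]
      linarith)
    have h2 := hpos (σ j k • x - lin (σ j) x • Pi.single k 1) (by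
      rw [lin_sub, lin_smul, lin_smul, lin_single]
      linarith)
    rw [lin_sub, lin_smul, lin_smul, lin_single] at h1 h2
    linarith
  have hdvd : lin (σ j) x ∣ lin (ξ i) x := by
    have : lin (σ j) x ∣ Finset.univ.gcd fun k => lin (ξ i) x * σ j k :=
      Finset.dvd_gcd fun k _ => ⟨ξ i k, (hprop k).symm⟩
    rwa [Finset.gcd_mul_left, hprim, mul_one, dvd_normalize_iff] at this
  obtain ⟨e, he⟩ := hdvd
  refine ⟨i, e, ?_, ?_⟩
  · by_contra! h0
    nlinarith
  · funext k
    have := hprop k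
    rw [he, mul_assoc] at this
    exact mul_left_cancel₀ hxj.ne this

/-- Proposition: pure embeddings into free semigroups.
`S ⊆ ℤ^r` is a positive normal affine semigroup with `gp(S) = ℤ^r`, given irredundantly
by its support forms `σ_1, …, σ_s`.  Let `ξ_1, …, ξ_n` be linear forms, nonnegative on `S`,
such that `ξ = (ξ_1, …, ξ_n)` is injective on `S`.  Then `ξ(S)` is a pure subsemigroup of
`ℤ_+^n`, i.e. `ξ(S) = ℤ_+^n ∩ ξ(ℤ^r)`, if and only if `n ≥ s` and, after renumbering by an
injection `ι`, there are positive integers `e_i` with `ξ_{ι i} = e_i σ_i`; moreover, in that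
case every `ξ_j` is a nonnegative rational linear combination of the support forms. -/
theorem pure_embedding_characterization
    {r s n : ℕ}
    (S : AddSubmonoid (Fin r → ℤ)) (σ : Fin s → Fin r → ℤ)
    (hSfg : S.FG)
    (hSpos : ∀ x ∈ S, -x ∈ S → x = 0)
    (hSgp : ∀ x : Fin r → ℤ, ∃ a ∈ S, ∃ b ∈ S, x = a - b)
    (hrep : ∀ x : Fin r → ℤ, x ∈ S ↔ ∀ i, 0 ≤ lin (σ i) x)
    (hirr : ∀ j, ∃ x : Fin r → ℤ, lin (σ j) x < 0 ∧ ∀ i, i ≠ j → 0 ≤ lin (σ i) x)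
    (hprim : ∀ i, Finset.univ.gcd (σ i) = 1)
    (ξ : Fin n → Fin r → ℤ)
    (hξpos : ∀ x ∈ S, ∀ i, 0 ≤ lin (ξ i) x)
    (hξinj : ∀ x ∈ S, ∀ y ∈ S, formsHom ξ x = formsHom ξ y → x = y) :
    (({t : Fin n → ℤ | ∃ x ∈ S, formsHom ξ x = t} =
        {t : Fin n → ℤ | (∀ i, 0 ≤ t i) ∧ ∃ x : Fin r → ℤ, formsHom ξ x = t}) ↔
      (s ≤ n ∧ ∃ ι : Fin s → Fin n, Function.Injective ι ∧
        ∃ e : Fin s → ℤ, (∀ i, 0 < e i) ∧ ∀ i, ξ (ι i) = e i • σ i)) ∧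
    (({t : Fin n → ℤ | ∃ x ∈ S, formsHom ξ x = t} =
        {t : Fin n → ℤ | (∀ i, 0 ≤ t i) ∧ ∃ x : Fin r → ℤ, formsHom ξ x = t}) →
      ∀ j, ∃ q : Fin s → ℚ, (∀ i, 0 ≤ q i) ∧
        ∀ k, (ξ j k : ℚ) = ∑ i, q i * (σ i k : ℚ)) := by
  have hinj : ∀ x y, formsHom ξ x = formsHom ξ y → x = y := by
    intro x y hxy
    obtain ⟨a, ha, b, hb, hab⟩ := hSgp (x - y)
    have h0 : formsHom ξ (a - b) = 0 := by rw [← hab, map_sub, hxy, sub_self]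
    rw [map_sub, sub_eq_zero] at h0
    rw [hξinj a ha b hb h0, sub_self] at hab
    exact sub_eq_zero.1 hab
  have hpure : ({t : Fin n → ℤ | ∃ x ∈ S, formsHom ξ x = t} =
      {t : Fin n → ℤ | (∀ i, 0 ≤ t i) ∧ ∃ x : Fin r → ℤ, formsHom ξ x = t}) ↔
      ∀ x, (∀ i, 0 ≤ lin (ξ i) x) → x ∈ S := by
    constructor
    · intro h x hx
      obtain ⟨y, hy, hyx⟩ := (Set.ext_iff.1 h (formsHom ξ x)).2 ⟨hx, x, rfl⟩
      rwa [← hinj y x hyx]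
    · intro h
      ext t
      constructor
      · rintro ⟨x, hx, rfl⟩
        exact ⟨hξpos x hx, x, rfl⟩
      · rintro ⟨ht, x, rfl⟩
        exact ⟨x, h x ht, rfl⟩
  refine ⟨hpure.trans ⟨fun h => ?_, ?_⟩, fun _ j =>
    exists_rat_coeffs_of_forall_nonneg σ (ξ j) fun x hx => hξpos x ((hrep x).2 hx) j⟩
  · have hint : ∀ i, ∃ b ∈ S, 0 < lin (σ i) b := by
      intro i
      obtain ⟨x, hx, -⟩ := hirr i
      obtain ⟨a, ha, b, hb, rfl⟩ := hSgp x
      rw [lin_sub] at hx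
      exact ⟨b, hb, by linarith [(hrep a).1 ha i]⟩
    choose b hbS hb using hint
    have hy : ∀ i, 0 < lin (σ i) (∑ k, b k) := fun i => by
      rw [lin_sum]
      exact Finset.sum_pos' (fun k _ => (hrep _).1 (hbS k) i) ⟨i, Finset.mem_univ i, hb i⟩
    have hex : ∀ j, ∃ i, ∃ e : ℤ, 0 < e ∧ ξ i = e • σ j := fun j => by
      obtain ⟨x, hxj, hx⟩ := hirr j
      exact exists_eq_smul_of_nonneg_iff
        (fun x => ⟨fun hx => hξpos x ((hrep x).2 hx), fun hx => (hrep x).1 (h x hx)⟩)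
        (hprim j) hxj hx hy
    choose ι e he hιe using hex
    have hι : Function.Injective ι := by
      intro j k hjk
      by_contra hne
      obtain ⟨x, hxj, hx⟩ := hirr j
      have h1 : e j * lin (σ j) x = e k * lin (σ k) x := by
        rw [← lin_smul_left, ← lin_smul_left, ← hιe, ← hιe, hjk]
      have h2 := mul_neg_of_pos_of_neg (he j) hxj
      have h3 := mul_nonneg (he k).le (hx k (Ne.symm hne))
      linarith
    exact ⟨by simpa using Fintype.card_le_of_injective ι hι, ι, hι, e, he, hιe⟩
  · rintro ⟨-, ι, -, e, he, hιe⟩ x hx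
    refine (hrep x).2 fun i => ?_
    have := hx (ι i)
    rw [hιe, lin_smul_left] at this
    exact nonneg_of_mul_nonneg_right this (he i)
end
end

section
/- Let S be a positive normal affine semigroup with gp(S) = ℤ^r, support forms σ_1,…,σ_s and σ = (σ_1,…,σ_s) : ℤ^r → ℤ^s. If ξ = (ξ_1,…,ξ_n) : ℤ^r → ℤ^n is given by linear forms nonnegative on S and restricts to a pure embedding of S into ℤ_+^n (i.e. ξ is injective and ξ(S) = ℤ_+^n ∩ ξ(ℤ^r)), then the group ℤ^s/σ(ℤ^r) (isomorphic to the divisor class group Cl(K[S])) is isomorphic to a subquotient of ℤ^n/ξ(ℤ^r), that is, to a quotient group of a subgroup of ℤ^n/ξ(ℤ^r). -/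
set_option synthInstance.maxHeartbeats 1000000
set_option maxHeartbeats 1000000

open scoped BigOperators

noncomputable section

/-- The linear form `x ↦ lin f x` as an additive homomorphism. -/
def linHom {r : ℕ} (f : Fin r → ℤ) : (Fin r → ℤ) →+ ℤ where
  toFun := lin f
  map_zero' := lin_zero f
  map_add' := lin_add f

lemma lin_neg {r : ℕ} (f x : Fin r → ℤ) : lin f (-x) = -lin f x :=
  (linHom f).map_neg x

lemma lin_zsmul {r : ℕ} (f : Fin r → ℤ) (c : ℤ) (x : Fin r → ℤ) :
    lin f (c • x) = c * lin f x :=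
  (linHom f).map_zsmul c x

lemma lin_finsetSum {r : ℕ} {ι : Type*} (f : Fin r → ℤ) (t : Finset ι) (x : ι → Fin r → ℤ) :
    lin f (∑ i ∈ t, x i) = ∑ i ∈ t, lin f (x i) :=
  map_sum (linHom f) x t

/-- A primitive integral linear form takes the value `1`. -/
lemma exists_lin_eq_one {r : ℕ} {f : Fin r → ℤ} (hf : Finset.univ.gcd f = 1) :
    ∃ w, lin f w = 1 := by
  obtain ⟨w, hw⟩ := Finset.univ.gcd_eq_sum_mul f
  exact ⟨w, by rw [lin, ← hw, hf]⟩

/-- Large multiples of a nonnegative family dominate any family that is nonnegative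
wherever the former vanishes. -/
lemma exists_forall_mul_add_nonneg {ι : Type*} [Fintype ι] {a b : ι → ℤ}
    (ha : ∀ k, 0 ≤ a k) (hb : ∀ k, a k = 0 → 0 ≤ b k) :
    ∃ N : ℤ, ∀ k, 0 ≤ N * a k + b k := by
  refine ⟨∑ k, |b k|, fun k => ?_⟩
  rcases (ha k).eq_or_lt with h | h
  · simpa [← h] using hb k h.symm
  · have h1 : |b k| ≤ ∑ k, |b k| :=
      Finset.single_le_sum (f := fun k => |b k|) (fun i _ => abs_nonneg _) (Finset.mem_univ k)
    have h2 := neg_abs_le (b k)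
    nlinarith [abs_nonneg (b k)]

/-- A surjection from a subgroup `U` that kills `K` exhibits its target as a subquotient
of `G ⧸ K`. -/
lemma exists_subquotient_equiv {G A : Type*} [AddCommGroup G] [AddCommGroup A]
    (K U : AddSubgroup G) (f : U →+ A) (hf : Function.Surjective f)
    (hK : ∀ u : U, (u : G) ∈ K → f u = 0) :
    ∃ (H : AddSubgroup (G ⧸ K)) (N : AddSubgroup H), Nonempty (A ≃+ H ⧸ N) := by
  let q := (QuotientAddGroup.mk' K).addSubgroupMap U
  have hq : Function.Surjective q := (QuotientAddGroup.mk' K).addSubgroupMap_surjective U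
  have hker : q.ker ≤ f.ker := fun u hu => hK u <| by
    have : QuotientAddGroup.mk' K (u : G) = 0 := congrArg Subtype.val hu
    simpa using this
  let g := q.liftOfSurjective hq ⟨f, hker⟩
  have hg : Function.Surjective g := fun a => by
    obtain ⟨u, rfl⟩ := hf a
    exact ⟨q u, q.liftOfRightInverse_comp_apply _ _ ⟨f, hker⟩ u⟩
  exact ⟨_, g.ker, ⟨(QuotientAddGroup.quotientKerEquivOfSurjective g hg).symm⟩⟩

/-- If coordinates of `ξ` are, injectively, nonzero multiples of the forms `σ i`, then
`ℤ^s/σ(ℤ^r)` is a subquotient of `ℤ^n/ξ(ℤ^r)`. -/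
lemma exists_classGroup_equiv_of_multiples {r s n : ℕ} {σ : Fin s → Fin r → ℤ}
    {ξ : Fin n → Fin r → ℤ} (j : Fin s → Fin n) (hj : Function.Injective j) (m : Fin s → ℤ)
    (hm : ∀ i, m i ≠ 0) (h : ∀ i x, lin (ξ (j i)) x = m i * lin (σ i) x) :
    ∃ (H : AddSubgroup ((Fin n → ℤ) ⧸ formsRange ξ)) (N : AddSubgroup ↥H),
      Nonempty ((classGroup σ) ≃+ (↥H ⧸ N)) := by
  let U : AddSubgroup (Fin n → ℤ) :=
    { carrier := {t | ∀ i, m i ∣ t (j i)}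
      zero_mem' := fun i => dvd_zero _
      add_mem' := fun ha hb i => dvd_add (ha i) (hb i)
      neg_mem' := fun ha i => (dvd_neg).2 (ha i) }
  let d : U →+ (Fin s → ℤ) :=
    { toFun := fun t i => t.1 (j i) / m i
      map_zero' := by funext i; simp
      map_add' := fun a b => by
        funext i
        exact Int.add_ediv_of_dvd_left (a.2 i) }
  have hd : Function.Surjective d := fun v => by
    have he : ∀ i, Function.extend j (fun i => m i * v i) 0 (j i) = m i * v i :=
      fun i => hj.extend_apply _ _ i
    refine ⟨⟨Function.extend j (fun i => m i * v i) 0, fun i => ?_⟩, ?_⟩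
    · rw [he]
      exact dvd_mul_right _ _
    · funext i
      change Function.extend j (fun i => m i * v i) 0 (j i) / m i = v i
      rw [he, Int.mul_ediv_cancel_left _ (hm i)]
  refine exists_subquotient_equiv (formsRange ξ) U
    ((QuotientAddGroup.mk' (formsRange σ)).comp d)
    ((QuotientAddGroup.mk'_surjective _).comp hd) ?_
  rintro ⟨_, hu⟩ ⟨x, rfl⟩
  refine (QuotientAddGroup.eq_zero_iff _).2 ⟨x, ?_⟩
  funext i
  change lin (σ i) x = lin (ξ (j i)) x / m i
  rw [h, Int.mul_ediv_cancel_left _ (hm i)]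

/-- If two systems of homogeneous inequalities have the same integral solutions, every
irredundant primitive form of the first is, up to a positive factor, a form of the second. -/
lemma exists_pos_multiple {r s n : ℕ} {σ : Fin s → Fin r → ℤ} {ξ : Fin n → Fin r → ℤ}
    (heq : ∀ x, (∀ i, 0 ≤ lin (σ i) x) ↔ ∀ k, 0 ≤ lin (ξ k) x)
    {y : Fin r → ℤ} (hy : ∀ i, 0 < lin (σ i) y)
    {i : Fin s} (hprim : Finset.univ.gcd (σ i) = 1)
    {x : Fin r → ℤ} (hx : lin (σ i) x < 0) (hx' : ∀ k, k ≠ i → 0 ≤ lin (σ k) x) :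
    ∃ (j : Fin n) (m : ℤ), 0 < m ∧ ∀ z, lin (ξ j) z = m * lin (σ i) z := by
  obtain ⟨p, hp0, hp⟩ : ∃ p, lin (σ i) p = 0 ∧ ∀ k, k ≠ i → 0 < lin (σ k) p := by
    refine ⟨lin (σ i) y • x - lin (σ i) x • y, ?_, fun k hk => ?_⟩
    · rw [lin_sub, lin_zsmul, lin_zsmul]
      ring
    · rw [lin_sub, lin_zsmul, lin_zsmul]
      nlinarith [mul_nonneg (hy i).le (hx' k hk), mul_pos_of_neg_of_neg hx (neg_lt_zero.2 (hy k))]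
  have hpσ : ∀ k, 0 ≤ lin (σ k) p := fun k => by
    rcases eq_or_ne k i with rfl | hk
    · exact hp0.ge
    · exact (hp k hk).le
  have hpξ := (heq p).1 hpσ
  obtain ⟨j, hjp, hjx⟩ : ∃ j, lin (ξ j) p = 0 ∧ lin (ξ j) x < 0 := by
    by_contra! hcon
    obtain ⟨N, hN⟩ := exists_forall_mul_add_nonneg hpξ hcon
    have := (heq (N • p + x)).2 (fun k => by rw [lin_add, lin_zsmul]; exact hN k) i
    rw [lin_add, lin_zsmul, hp0] at this
    linarith
  have hnonneg : ∀ z, lin (σ i) z = 0 → 0 ≤ lin (ξ j) z := fun z hz => by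
    obtain ⟨N, hN⟩ := exists_forall_mul_add_nonneg (b := fun k => lin (σ k) z) hpσ
      (fun k hk => by
        rcases eq_or_ne k i with rfl | hki
        · exact hz.ge
        · exact absurd hk (hp k hki).ne')
    have := (heq (N • p + z)).1 (fun k => by rw [lin_add, lin_zsmul]; exact hN k) j
    rwa [lin_add, lin_zsmul, hjp, mul_zero, zero_add] at this
  obtain ⟨w, hw⟩ := exists_lin_eq_one hprim
  have hmul : ∀ z, lin (ξ j) z = lin (ξ j) w * lin (σ i) z := fun z => by
    have hz : lin (σ i) (z - lin (σ i) z • w) = 0 := by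
      rw [lin_sub, lin_zsmul, hw]
      ring
    have h1 := hnonneg _ hz
    have h2 := hnonneg (-(z - lin (σ i) z • w)) (by rw [lin_neg, hz, neg_zero])
    rw [lin_neg] at h2
    rw [lin_sub, lin_zsmul] at h1 h2
    linarith
  refine ⟨j, lin (ξ j) w, ?_, hmul⟩
  have := hmul x
  by_contra! hneg
  nlinarith

/-- Corollary: the divisor class group is a subquotient.
If `ξ : ℤ^r → ℤ^n` restricts to a pure embedding of the positive normal affine semigroup `S`
into `ℤ_+^n`, then `ℤ^s/σ(ℤ^r) ≅ Cl(K[S])` is isomorphic to a subquotient of `ℤ^n/ξ(ℤ^r)`,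
i.e. to a quotient group of a subgroup of `ℤ^n/ξ(ℤ^r)`. -/
theorem class_group_subquotient
    {r s n : ℕ}
    (S : AddSubmonoid (Fin r → ℤ)) (σ : Fin s → Fin r → ℤ)
    (hSfg : S.FG)
    (hSpos : ∀ x ∈ S, -x ∈ S → x = 0)
    (hSgp : ∀ x : Fin r → ℤ, ∃ a ∈ S, ∃ b ∈ S, x = a - b)
    (hrep : ∀ x : Fin r → ℤ, x ∈ S ↔ ∀ i, 0 ≤ lin (σ i) x)
    (hirr : ∀ j, ∃ x : Fin r → ℤ, lin (σ j) x < 0 ∧ ∀ i, i ≠ j → 0 ≤ lin (σ i) x)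
    (hprim : ∀ i, Finset.univ.gcd (σ i) = 1)
    (ξ : Fin n → Fin r → ℤ)
    (hξpos : ∀ x ∈ S, ∀ i, 0 ≤ lin (ξ i) x)
    (hξinj : Function.Injective (formsHom ξ))
    (hpure : {t : Fin n → ℤ | ∃ x ∈ S, formsHom ξ x = t} =
      {t : Fin n → ℤ | (∀ i, 0 ≤ t i) ∧ ∃ x : Fin r → ℤ, formsHom ξ x = t}) :
    ∃ (H : AddSubgroup ((Fin n → ℤ) ⧸ formsRange ξ)) (N : AddSubgroup ↥H),
      Nonempty ((classGroup σ) ≃+ (↥H ⧸ N)) := by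
  have heq : ∀ x, (∀ i, 0 ≤ lin (σ i) x) ↔ ∀ k, 0 ≤ lin (ξ k) x := fun x => by
    rw [← hrep]
    refine ⟨hξpos x, fun h => ?_⟩
    have hmem : formsHom ξ x ∈ {t : Fin n → ℤ | ∃ x ∈ S, formsHom ξ x = t} := by
      rw [hpure]
      exact ⟨h, x, rfl⟩
    obtain ⟨x', hx', hxx'⟩ := hmem
    exact hξinj hxx' ▸ hx'
  have hpoint : ∀ i, ∃ a ∈ S, 0 < lin (σ i) a := fun i => by
    obtain ⟨w, hw⟩ := exists_lin_eq_one (hprim i)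
    obtain ⟨a, ha, b, hb, rfl⟩ := hSgp w
    refine ⟨a, ha, ?_⟩
    have := (hrep b).1 hb i
    rw [lin_sub] at hw
    linarith
  choose a haS ha using hpoint
  have hy : ∀ i, 0 < lin (σ i) (∑ k, a k) := fun i => by
    rw [lin_finsetSum]
    exact Finset.sum_pos' (fun k _ => (hrep _).1 (haS k) i) ⟨i, Finset.mem_univ i, ha i⟩
  choose x hx hx' using hirr
  choose j m hm hjm using fun i => exists_pos_multiple heq hy (hprim i) (hx i) (hx' i)
  refine exists_classGroup_equiv_of_multiples j (fun i i' hii' => ?_) m (fun i => (hm i).ne') hjm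
  by_contra hne
  have h1 := hjm i (x i)
  rw [hii', hjm i'] at h1
  have h2 := mul_nonneg (hm i').le (hx' i i' (Ne.symm hne))
  have h3 := mul_neg_of_pos_of_neg (hm i) (hx i)
  linarith
end
end
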